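/- arXiv:1307.7691 — 2 statements merged into one kernel-verified Lean document; each statement's English description precedes it below -/
import Mathlib

section
/- Let p be an odd prime, n ≥ 1 an integer, and q ∈ ℚ_p^× an element whose p-adic valuation v_p(q) ∈ ℤ is not divisible by p. Then every element x of ℚ_p^× can be written as x = q^a · (1+p)^b · y^(pⁿ) with integers a, b and y ∈ ℚ_p^×; in other words, the classes of q and of 1+p generate the quotient group ℚ_p^×/(ℚ_p^×)^(pⁿ). -/
/-- In a finite cyclic group, the `orderOf c`-torsion is the subgroup generated by `c`. -/
theorem IsCyclic.mem_zpowers_of_pow_orderOf_eq_one {G : Type*} [Group G] [Finite G] [IsCyclic G]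
    {c x : G} (hx : x ^ orderOf c = 1) : x ∈ Subgroup.zpowers c := by
  classical
  have := Fintype.ofFinite G
  have hsub : (Subgroup.zpowers c : Set G).toFinset ⊆
      Finset.univ.filter fun a : G => a ^ orderOf c = 1 := by
    intro a ha
    obtain ⟨k, rfl⟩ := Set.mem_toFinset.mp ha
    have h : (c ^ k) ^ orderOf c = 1 := by
      rw [← zpow_natCast, zpow_comm, zpow_natCast, pow_orderOf_eq_one, one_zpow]
    exact Finset.mem_filter.mpr ⟨Finset.mem_univ _, h⟩
  have hcard : (Finset.univ.filter fun a : G => a ^ orderOf c = 1).card ≤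
      (Subgroup.zpowers c : Set G).toFinset.card := by
    refine (IsCyclic.card_pow_eq_one_le (orderOf_pos c)).trans_eq ?_
    rw [Set.toFinset_card, ← Nat.card_eq_fintype_card]
    exact (Nat.card_zpowers c).symm
  have hmem : x ∈ Finset.univ.filter fun a : G => a ^ orderOf c = 1 := by simpa using hx
  rw [← Finset.eq_of_subset_of_card_le hsub hcard] at hmem
  simpa using hmem

/-- A subgroup contains `x` as soon as it contains two powers of `x`
with coprime exponents. -/
theorem Subgroup.mem_of_zpow_mem_of_isCoprime {G : Type*} [Group G] (H : Subgroup G) {x : G}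
    {a b : ℤ} (hab : IsCoprime a b) (ha : x ^ a ∈ H) (hb : x ^ b ∈ H) : x ∈ H := by
  obtain ⟨s, t, hst⟩ := hab
  have h := H.mul_mem (H.zpow_mem ha s) (H.zpow_mem hb t)
  rwa [← zpow_mul, ← zpow_mul, ← zpow_add, mul_comm a, mul_comm b, hst, zpow_one] at h

namespace PadicInt

variable {p : ℕ} [Fact p.Prime]

/-- A `p`-adic integer congruent to `1` modulo `p ^ (2 * n + 1)` is a `p ^ n`-th power. -/
theorem exists_pow_prime_pow_eq_of_sub_one_mem {n : ℕ} {v : ℤ_[p]}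
    (hv : v - 1 ∈ Ideal.span {(p : ℤ_[p]) ^ (2 * n + 1)}) : ∃ y : ℤ_[p], y ^ p ^ n = v := by
  have hp : (1 : ℝ) < p := mod_cast (Fact.out : p.Prime).one_lt
  rw [← norm_le_pow_iff_mem_span_pow] at hv
  let F : Polynomial ℤ_[p] := Polynomial.X ^ p ^ n - Polynomial.C v
  have hF' : F.derivative.aeval (1 : ℤ_[p]) = (p : ℤ_[p]) ^ n := by
    simp [F, Polynomial.derivative_X_pow]
  have hF : F.aeval (1 : ℤ_[p]) = -(v - 1) := by simp [F]
  have hnorm : ‖F.aeval (1 : ℤ_[p])‖ < ‖F.derivative.aeval (1 : ℤ_[p])‖ ^ 2 := by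
    rw [hF, hF', norm_neg, norm_p_pow, ← zpow_natCast, ← zpow_mul]
    exact hv.trans_lt (zpow_lt_zpow_right₀ hp (by push_cast; omega))
  obtain ⟨z, hz, -⟩ := hensels_lemma hnorm
  exact ⟨z, sub_eq_zero.mp (by simpa [F] using hz)⟩

/-- For odd `p`, the `(p - 1)`-th power of a `p`-adic unit is congruent to a power of a given
unit `1 + p` modulo any power of `p`. -/
theorem exists_pow_sub_one_sub_zpow_mem (hp2 : p ≠ 2) {e : ℤ_[p]ˣ} (he : (e : ℤ_[p]) = 1 + p)
    (u : ℤ_[p]ˣ) (m : ℕ) :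
    ∃ k : ℤ, ((u ^ (p - 1) * (e ^ k)⁻¹ : ℤ_[p]ˣ) : ℤ_[p]) - 1 ∈
      Ideal.span {(p : ℤ_[p]) ^ (m + 1)} := by
  have hp : p.Prime := Fact.out
  have := ZMod.isCyclic_units_of_prime_pow p hp hp2 (m + 1)
  let f := Units.map (toZModPow (p := p) (m + 1) : ℤ_[p] →* ZMod (p ^ (m + 1)))
  have hord : orderOf (f e) = p ^ m := by
    rw [← orderOf_units, ← ZMod.orderOf_one_add_prime hp hp2 m]
    simp [f, he]
  have htors : f (u ^ (p - 1)) ^ orderOf (f e) = 1 := by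
    rw [hord, map_pow, ← pow_mul, mul_comm, ← Nat.totient_prime_pow_succ hp, ZMod.pow_totient]
  obtain ⟨k, hk⟩ := IsCyclic.mem_zpowers_of_pow_orderOf_eq_one htors
  refine ⟨k, ?_⟩
  have hone : f (u ^ (p - 1) * (e ^ k)⁻¹) = 1 := by
    rw [map_mul, map_inv, map_zpow, ← hk, mul_inv_cancel]
  rw [← ker_toZModPow, RingHom.mem_ker, map_sub, map_one, sub_eq_zero]
  exact congrArg Units.val hone

/-- For odd `p`, the `(p - 1)`-th power of a `p`-adic unit is a power of `1 + p` times a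
`p ^ n`-th power. -/
theorem exists_pow_sub_one_eq_zpow_mul_pow (hp2 : p ≠ 2) {e : ℤ_[p]ˣ}
    (he : (e : ℤ_[p]) = 1 + p) (u : ℤ_[p]ˣ) (n : ℕ) :
    ∃ (k : ℤ) (y : ℤ_[p]ˣ), u ^ (p - 1) = e ^ k * y ^ p ^ n := by
  obtain ⟨k, hk⟩ := exists_pow_sub_one_sub_zpow_mem hp2 he u (2 * n)
  obtain ⟨y, hy⟩ := exists_pow_prime_pow_eq_of_sub_one_mem hk
  have hyu : IsUnit y := (isUnit_pow_iff (pow_ne_zero n (Fact.out : p.Prime).ne_zero)).mp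
    (hy ▸ Units.isUnit _)
  obtain ⟨y, rfl⟩ := hyu
  refine ⟨k, y, ?_⟩
  have : y ^ p ^ n = u ^ (p - 1) * (e ^ k)⁻¹ := Units.ext (by simpa using hy)
  rw [this, mul_comm, inv_mul_cancel_right]

end PadicInt

/-- Let `p` be an odd prime, `n ≥ 1`, and `q ∈ ℚ_p^×` with
`p ∤ v_p(q)`. Then every `x ∈ ℚ_p^×` can be written as
`x = q^a · (1+p)^b · y^(pⁿ)`; i.e. the classes of `q` and `1+p` generate
`ℚ_p^×/(ℚ_p^×)^(pⁿ)`. -/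
theorem padic_units_generated_by_q_and_one_add_p (p : ℕ) [Fact p.Prime] (hodd : Odd p)
    (n : ℕ) (hn : 1 ≤ n) (q ε : ℚ_[p]ˣ)
    (hq : ¬ (p : ℤ) ∣ (q : ℚ_[p]).valuation)
    (hε : (ε : ℚ_[p]) = 1 + (p : ℚ_[p])) :
    ∀ x : ℚ_[p]ˣ, ∃ (a b : ℤ) (y : ℚ_[p]ˣ), x = q ^ a * ε ^ b * y ^ (p ^ n) := by
  have hp : p.Prime := Fact.out
  have hp2 : p ≠ 2 := by rintro rfl; exact absurd hodd (by decide)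
  intro x
  let H : Subgroup ℚ_[p]ˣ :=
    Subgroup.zpowers q ⊔ Subgroup.zpowers ε ⊔ (powMonoidHom (p ^ n)).range
  have hqH : q ∈ H := Subgroup.mem_sup_left (Subgroup.mem_sup_left (Subgroup.mem_zpowers q))
  have hεH : ε ∈ H := Subgroup.mem_sup_left (Subgroup.mem_sup_right (Subgroup.mem_zpowers ε))
  have hpowH (y : ℚ_[p]ˣ) : y ^ p ^ n ∈ H := Subgroup.mem_sup_right ⟨y, rfl⟩
  suffices hx : x ∈ H by
    obtain ⟨w, hw, _, ⟨y, rfl⟩, rfl⟩ := Subgroup.mem_sup.mp hx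
    obtain ⟨_, ⟨a, rfl⟩, _, ⟨b, rfl⟩, rfl⟩ := Subgroup.mem_sup.mp hw
    exact ⟨a, b, y, rfl⟩
  let ι := Units.map (PadicInt.Coe.ringHom (p := p) : ℤ_[p] →* ℚ_[p])
  have hunit (w : ℚ_[p]ˣ) (hw : ‖(w : ℚ_[p])‖ = 1) : ι (PadicInt.mkUnits hw) = w :=
    Units.ext rfl
  have hε1 : ‖(ε : ℚ_[p])‖ = 1 := by
    have h := PadicInt.isUnit_iff.mp
      (IsLocalRing.isUnit_one_sub_self_of_mem_nonunits (-(p : ℤ_[p])) (by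
        simpa using PadicInt.p_nonunit (p := p)))
    rw [hε]
    simpa [PadicInt.norm_def] using h
  have he : (PadicInt.mkUnits hε1 : ℤ_[p]) = 1 + p := PadicInt.ext (by simpa using hε)
  have hmem (w : ℚ_[p]ˣ) (hw : ‖(w : ℚ_[p])‖ = 1) : w ^ (p - 1) ∈ H := by
    obtain ⟨k, y, hy⟩ :=
      PadicInt.exists_pow_sub_one_eq_zpow_mul_pow hp2 he (PadicInt.mkUnits hw) n
    have h := congrArg ι hy
    rw [map_mul, map_pow, map_pow, map_zpow, hunit, hunit] at h
    rw [h]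
    exact H.mul_mem (H.zpow_mem hεH k) (hpowH _)
  set m := (q : ℚ_[p]).valuation
  set e := (x : ℚ_[p]).valuation
  have hnorm : ‖((x ^ m * (q ^ e)⁻¹ : ℚ_[p]ˣ) : ℚ_[p])‖ = 1 := by
    rw [Padic.norm_eq_zpow_neg_valuation (Units.ne_zero _)]
    have : ((x ^ m * (q ^ e)⁻¹ : ℚ_[p]ˣ) : ℚ_[p]).valuation = 0 := by
      rw [Units.val_mul, Padic.valuation_mul (Units.ne_zero _) (Units.ne_zero _)]
      simp only [Units.val_inv_eq_inv_val, Units.val_zpow_eq_zpow_val, Padic.valuation_inv,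
        Padic.valuation_zpow]
      ring
    rw [this, neg_zero, zpow_zero]
  have hxm : x ^ (m * (p - 1 : ℕ)) ∈ H := by
    have h := H.mul_mem (hmem _ hnorm) (H.pow_mem (H.zpow_mem hqH e) (p - 1))
    rwa [← mul_pow, inv_mul_cancel_right, ← zpow_natCast, ← zpow_mul] at h
  refine H.mem_of_zpow_mem_of_isCoprime (b := (p ^ n : ℕ)) ?_ hxm
    (by rw [zpow_natCast]; exact hpowH x)
  rw [Nat.cast_pow]
  refine IsCoprime.pow_right (IsCoprime.mul_left ?_ ?_)
  · exact ((Nat.prime_iff_prime_int.mp hp).coprime_iff_not_dvd.mpr hq).symm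
  · rw [Nat.isCoprime_iff_coprime]
    exact ((Nat.coprime_self_sub_right hp.one_le).mpr (Nat.coprime_one_right p)).symm
end

section
/- Let p be an odd prime and n ≥ 1 an integer; fix an algebraic closure Ω of ℚ_p. Let q ∈ ℚ_p^× be an element whose p-adic valuation is not divisible by p, and let 𝒦 be an intermediate field of Ω/ℚ_p containing a primitive pⁿ-th root of unity and containing an element β with β^(pⁿ) = q. Let a₁, …, a_r ∈ ℚ_p^×, let t₁, …, t_r ∈ Ω satisfy t_j^(pⁿ) = a_j for each j, and let s ∈ Ω satisfy s^(pⁿ) = 1 + p. Then t_j ∈ 𝒦(s) for every j; consequently 𝒦(t₁, …, t_r) ⊆ 𝒦(s), and the degree [𝒦(t₁, …, t_r) : 𝒦] divides pⁿ. -/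
theorem IsCyclic.mem_zpowers_of_pow_orderOf_eq_one_s15 {G : Type*} [CommGroup G] [Finite G]
    [IsCyclic G] {g y : G} (h : y ^ orderOf g = 1) : y ∈ Subgroup.zpowers g := by
  have hle : Subgroup.zpowers g ≤ (powMonoidHom (orderOf g) : G →* G).ker := by
    rw [Subgroup.zpowers_le]
    simp [MonoidHom.mem_ker, pow_orderOf_eq_one]
  have heq : Subgroup.zpowers g = (powMonoidHom (orderOf g) : G →* G).ker := by
    refine Subgroup.eq_of_le_of_card_ge hle ?_
    rw [IsCyclic.card_powMonoidHom_ker, Nat.card_zpowers]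
    exact Nat.gcd_le_right _ (orderOf_pos g)
  rw [heq]
  simpa [MonoidHom.mem_ker] using h

theorem IsPrimitiveRoot.mem_of_pow_eq_pow {K L : Type*} [Field K] [Field L] [Algebra K L]
    (E : IntermediateField K L) {N : ℕ} [NeZero N] {ζ x y : L} (hζ : IsPrimitiveRoot ζ N)
    (hζE : ζ ∈ E) (hy : y ∈ E) (h : x ^ N = y ^ N) : x ∈ E := by
  rcases eq_or_ne y 0 with rfl | hy0
  · have : x = 0 := by
      rw [zero_pow (NeZero.ne N)] at h
      exact pow_eq_zero_iff (NeZero.ne N) |>.1 h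
    rwa [this]
  · obtain ⟨i, -, hi⟩ := hζ.eq_pow_of_pow_eq_one (ξ := x / y)
      (by rw [div_pow, h, div_self (pow_ne_zero _ hy0)])
    rw [(eq_div_iff hy0).1 hi |>.symm]
    exact mul_mem (pow_mem hζE i) hy

theorem IsPrimitiveRoot.finrank_adjoin_simple_dvd {K L : Type*} [Field K] [Field L]
    [Algebra K L] {N : ℕ} [NeZero N] {ζ : K} (hζ : IsPrimitiveRoot ζ N) {s : L} {c : K}
    (hs : s ^ N = algebraMap K L c) :
    Module.finrank K (IntermediateField.adjoin K ({s} : Set L)) ∣ N := by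
  have hint : IsIntegral K s := by
    refine IsIntegral.of_pow (NeZero.pos N) ?_
    rw [hs]
    exact isIntegral_algebraMap
  set d := Module.finrank K (IntermediateField.adjoin K ({s} : Set L)) with hd
  have hdeg : d = (minpoly K s).natDegree := IntermediateField.adjoin.finrank hint
  have key (m : ℕ) (hm : m ≠ 0) (e : K) (h : s ^ m = algebraMap K L e) : d ≤ m := by
    have hne : (Polynomial.X ^ m - Polynomial.C e) ≠ 0 :=
      Polynomial.X_pow_sub_C_ne_zero (Nat.pos_of_ne_zero hm) e
    have hdvd := minpoly.dvd K s (p := Polynomial.X ^ m - Polynomial.C e) (by simp [h])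
    rw [hdeg, ← Polynomial.natDegree_X_pow_sub_C (n := m) (r := e)]
    exact Polynomial.natDegree_le_of_dvd hdvd hne
  have hdpos : 0 < d := hdeg ▸ minpoly.natDegree_pos hint
  rcases eq_or_ne s 0 with rfl | hs0
  · have := key 1 one_ne_zero 0 (by simp)
    have : d = 1 := by lia
    simp [this]
  have hdmem : s ^ d ∈ (⊥ : IntermediateField K L) := by
    have hgen : IntermediateField.AdjoinSimple.gen K s ^ N =
        algebraMap K (IntermediateField.adjoin K ({s} : Set L)) c := by
      apply Subtype.ext
      simpa using hs
    have hnorm := congrArg (Algebra.norm K) hgen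
    rw [map_pow, Algebra.norm_algebraMap, ← hd] at hnorm
    refine (hζ.map_of_injective (algebraMap K L).injective).mem_of_pow_eq_pow
      (y := algebraMap K L (Algebra.norm K (IntermediateField.AdjoinSimple.gen K s))) _
      (IntermediateField.algebraMap_mem _ _) (IntermediateField.algebraMap_mem _ _) ?_
    rw [← map_pow, hnorm, ← pow_mul, mul_comm, pow_mul, hs, map_pow]
  have hNmem : s ^ N ∈ (⊥ : IntermediateField K L) :=
    hs ▸ IntermediateField.algebraMap_mem _ _
  have hgmem : s ^ d.gcd N ∈ (⊥ : IntermediateField K L) := by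
    have : s ^ d.gcd N = (s ^ d) ^ d.gcdA N * (s ^ N) ^ d.gcdB N := by
      rw [← zpow_natCast s (d.gcd N), Nat.gcd_eq_gcd_ab, zpow_add₀ hs0, zpow_mul, zpow_mul,
        zpow_natCast, zpow_natCast]
    rw [this]
    exact mul_mem (zpow_mem hdmem _) (zpow_mem hNmem _)
  obtain ⟨e, he⟩ := IntermediateField.mem_bot.1 hgmem
  have hle := key _ (Nat.gcd_pos_of_pos_left _ hdpos).ne' e he.symm
  have : d.gcd N = d := le_antisymm (Nat.gcd_le_left _ hdpos) hle
  exact this ▸ Nat.gcd_dvd_right d N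

theorem PadicInt.exists_pow_eq_of_sub_pow_mem {p : ℕ} [Fact p.Prime] {n : ℕ} {b w : ℤ_[p]}
    (hb : IsUnit b) (h : b ^ p ^ n - w ∈ Ideal.span {(p : ℤ_[p]) ^ (2 * n + 1)}) :
    ∃ z : ℤ_[p], z ^ p ^ n = w := by
  have hp1 : (1 : ℝ) < p := by exact_mod_cast (Fact.out : p.Prime).one_lt
  obtain ⟨z, hz, -⟩ := hensels_lemma (p := p)
    (F := (Polynomial.X ^ p ^ n - Polynomial.C w : Polynomial ℤ_[p])) (a := b) (by
      have h1 := (PadicInt.norm_le_pow_iff_mem_span_pow _ _).2 h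
      have h2 : ‖b‖ = 1 := PadicInt.isUnit_iff.1 hb
      simp only [Polynomial.derivative_X_pow, Polynomial.derivative_C,
        sub_zero, map_sub, map_mul, map_pow, Polynomial.aeval_X, Polynomial.aeval_C,
        Algebra.algebraMap_self, RingHom.id_apply, map_natCast, norm_mul, norm_pow, h2, one_pow,
        mul_one]
      refine h1.trans_lt ?_
      push_cast
      rw [norm_pow, PadicInt.norm_p, ← zpow_natCast, ← zpow_natCast, inv_zpow', ← zpow_mul]
      refine zpow_lt_zpow_right₀ hp1 ?_
      push_cast
      lia)
  exact ⟨z, by simpa [sub_eq_zero] using hz⟩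

theorem PadicInt.exists_pow_eq_mul_one_add_pow {p : ℕ} [Fact p.Prime] (hp2 : p ≠ 2) (n : ℕ)
    (u : ℤ_[p]ˣ) : ∃ (z : ℤ_[p]) (m : ℕ), z ^ p ^ n = u * (1 + p) ^ m := by
  have hp : p.Prime := Fact.out
  have hcyc := ZMod.isCyclic_units_of_prime_pow p hp hp2 (2 * n + 1)
  have hord := ZMod.orderOf_one_add_prime hp hp2 (2 * n)
  have : NeZero (p ^ (2 * n + 1)) := ⟨pow_ne_zero _ hp.ne_zero⟩
  obtain ⟨g, hg⟩ : IsUnit (1 + p : ZMod (p ^ (2 * n + 1))) := by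
    refine IsUnit.of_pow_eq_one (n := p ^ (2 * n)) ?_ (pow_ne_zero _ hp.ne_zero)
    rw [← hord, pow_orderOf_eq_one]
  have hgord : orderOf g = p ^ (2 * n) := by rw [← orderOf_units, hg, hord]
  let v : (ZMod (p ^ (2 * n + 1)))ˣ := Units.map (toZModPow (2 * n + 1) : ℤ_[p] →+* _) u
  have hv : v ^ (p ^ (2 * n) * (p - 1)) = 1 := by
    have := ZMod.pow_totient v
    rwa [Nat.totient_prime_pow_succ hp] at this
  obtain ⟨k, hk⟩ : p - 1 ∣ p ^ (2 * n) - 1 := by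
    simpa using Nat.sub_dvd_pow_sub_pow p 1 (2 * n)
  have hmem : v ^ (p ^ (2 * n) - 1) ∈ Subgroup.zpowers g := by
    apply IsCyclic.mem_zpowers_of_pow_orderOf_eq_one_s15
    rw [hgord, ← pow_mul, hk, show (p - 1) * k * p ^ (2 * n) = p ^ (2 * n) * (p - 1) * k by ring,
      pow_mul, hv, one_pow]
  obtain ⟨m, hm⟩ := mem_powers_iff_mem_zpowers.2 hmem
  simp only at hm
  have hvm : v ^ p ^ (2 * n) = v * g ^ m := by
    rw [hm, ← pow_succ', Nat.sub_add_cancel (Nat.one_le_pow _ _ hp.pos)]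
  obtain ⟨z, hz⟩ := exists_pow_eq_of_sub_pow_mem (n := n) (b := (u : ℤ_[p]) ^ p ^ n)
    (w := u * (1 + p) ^ m) (u.isUnit.pow _) (by
      rw [← ker_toZModPow, RingHom.mem_ker, ← pow_mul, ← pow_add, ← two_mul]
      have h := congrArg Units.val hvm
      simp only [Units.val_pow_eq_pow_val, Units.val_mul, hg, v, Units.coe_map] at h
      simpa [sub_eq_zero] using h)
  exact ⟨z, m, hz⟩

theorem Padic.exists_mul_one_add_pow_eq {p : ℕ} [Fact p.Prime] (hp2 : p ≠ 2) (n : ℕ)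
    {q a : ℚ_[p]} (hq0 : q ≠ 0) (hq : ¬ (p : ℤ) ∣ q.valuation) (ha : a ≠ 0) :
    ∃ (i : ℤ) (c : ℚ_[p]) (m : ℕ), a * (1 + p) ^ m = q ^ i * c ^ p ^ n := by
  have hp : p.Prime := Fact.out
  have hp0 : (p : ℚ_[p]) ≠ 0 := by exact_mod_cast hp.ne_zero
  obtain ⟨x, y, hxy⟩ : IsCoprime q.valuation ((p : ℤ) ^ n) :=
    (((Nat.prime_iff_prime_int.1 hp).coprime_iff_not_dvd.2 hq).symm).pow_right
  set i := a.valuation * x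
  set k := a.valuation * y
  have hik : a.valuation = i * q.valuation + k * p ^ n := by
    linear_combination (-a.valuation) * hxy
  have hd0 : q ^ i * ((p : ℚ_[p]) ^ k) ^ p ^ n ≠ 0 :=
    mul_ne_zero (zpow_ne_zero _ hq0) (pow_ne_zero _ (zpow_ne_zero _ hp0))
  set d := q ^ i * ((p : ℚ_[p]) ^ k) ^ p ^ n with hd
  have hdv : d.valuation = a.valuation := by
    rw [hd, Padic.valuation_mul (zpow_ne_zero _ hq0) (pow_ne_zero _ (zpow_ne_zero _ hp0)),
      Padic.valuation_pow, Padic.valuation_zpow, Padic.valuation_zpow, Padic.valuation_p, hik]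
    push_cast
    ring
  have hnorm : ‖a / d‖ = 1 := by
    rw [norm_div, Padic.norm_eq_zpow_neg_valuation ha, Padic.norm_eq_zpow_neg_valuation hd0, hdv,
      div_self]
    exact zpow_ne_zero _ (by exact_mod_cast hp.ne_zero)
  obtain ⟨z, m, hz⟩ := PadicInt.exists_pow_eq_mul_one_add_pow hp2 n (PadicInt.mkUnits hnorm)
  refine ⟨i, p ^ k * z, m, ?_⟩
  have h := congrArg (PadicInt.Coe.ringHom (p := p)) hz
  simp only [map_pow, map_mul, map_add, map_one, map_natCast] at h
  change (z : ℚ_[p]) ^ p ^ n = a / d * (1 + p) ^ m at h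
  rw [mul_pow, ← mul_assoc, ← hd, h, ← mul_assoc, mul_div_cancel₀ _ hd0]

/-- Let `p` be an odd prime, `n ≥ 1`, and `Ω` an algebraic closure of
`ℚ_p`. Let `q ∈ ℚ_p^×` with `p ∤ v_p(q)`, and let `𝒦` be an intermediate field of
`Ω/ℚ_p` containing a primitive `pⁿ`-th root of unity and a `pⁿ`-th root of `q`. If
`t₁, …, t_r` are `pⁿ`-th roots in `Ω` of elements of `ℚ_p^×` and `s` is a `pⁿ`-th root
of `1 + p`, then each `t_j` lies in `𝒦(s)`; consequently `𝒦(t₁, …, t_r) ⊆ 𝒦(s)` and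
`[𝒦(t₁, …, t_r) : 𝒦]` divides `pⁿ`. -/
theorem roots_in_cyclic_kummer_extension (p n r : ℕ) [Fact p.Prime] (hodd : Odd p)
    (hn : 1 ≤ n)
    (𝒦 : IntermediateField ℚ_[p] (AlgebraicClosure ℚ_[p]))
    (q : ℚ_[p]) (hq0 : q ≠ 0) (hq : ¬ (p : ℤ) ∣ q.valuation)
    (ζ : AlgebraicClosure ℚ_[p]) (hζK : ζ ∈ 𝒦) (hζ : IsPrimitiveRoot ζ (p ^ n))
    (β : AlgebraicClosure ℚ_[p]) (hβK : β ∈ 𝒦)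
    (hβ : β ^ (p ^ n) = algebraMap ℚ_[p] (AlgebraicClosure ℚ_[p]) q)
    (a : Fin r → ℚ_[p]) (ha : ∀ j, a j ≠ 0)
    (t : Fin r → AlgebraicClosure ℚ_[p])
    (ht : ∀ j, t j ^ (p ^ n) = algebraMap ℚ_[p] (AlgebraicClosure ℚ_[p]) (a j))
    (s : AlgebraicClosure ℚ_[p])
    (hs : s ^ (p ^ n) = algebraMap ℚ_[p] (AlgebraicClosure ℚ_[p]) (1 + p)) :
    (∀ j, t j ∈ IntermediateField.adjoin 𝒦 ({s} : Set (AlgebraicClosure ℚ_[p]))) ∧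
    IntermediateField.adjoin 𝒦 (Set.range t) ≤
      IntermediateField.adjoin 𝒦 ({s} : Set (AlgebraicClosure ℚ_[p])) ∧
    Module.finrank 𝒦 (IntermediateField.adjoin 𝒦 (Set.range t)) ∣ p ^ n := by
  have hp : p.Prime := Fact.out
  have hp2 : p ≠ 2 := by
    rintro rfl
    exact absurd hodd (by decide)
  have : NeZero (p ^ n) := ⟨pow_ne_zero _ hp.ne_zero⟩
  set E := IntermediateField.adjoin 𝒦 ({s} : Set (AlgebraicClosure ℚ_[p])) with hE
  have hsE : s ∈ E := IntermediateField.mem_adjoin_simple_self _ _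
  have hKE {x : AlgebraicClosure ℚ_[p]} (hx : x ∈ 𝒦) : x ∈ E :=
    E.algebraMap_mem (⟨x, hx⟩ : 𝒦)
  have hQE (x : ℚ_[p]) : algebraMap ℚ_[p] (AlgebraicClosure ℚ_[p]) x ∈ E :=
    hKE (𝒦.algebraMap_mem x)
  have hs0 : s ≠ 0 := by
    rintro rfl
    rw [zero_pow (NeZero.ne _), eq_comm, map_eq_zero] at hs
    have : ((1 + p : ℕ) : ℚ_[p]) = 0 := by exact_mod_cast hs
    exact (Nat.succ_ne_zero p) (by rw [← Nat.cast_eq_zero (R := ℚ_[p]), ← this]; push_cast; ring)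
  have hmem (j : Fin r) : t j ∈ E := by
    obtain ⟨i, c, m, h⟩ := Padic.exists_mul_one_add_pow_eq hp2 n hq0 hq (ha j)
    have hts : t j * s ^ m ∈ E := by
      refine hζ.mem_of_pow_eq_pow E (hKE hζK)
        (y := β ^ i * algebraMap ℚ_[p] (AlgebraicClosure ℚ_[p]) c)
        (mul_mem (zpow_mem (hKE hβK) i) (hQE c)) ?_
      rw [mul_pow, mul_pow, ht, ← pow_mul, mul_comm m, pow_mul, hs, ← zpow_natCast (β ^ i),
        zpow_comm, zpow_natCast β, hβ, ← map_pow, ← map_mul, h, map_mul, map_zpow₀, map_pow]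
    rw [← mul_div_cancel_right₀ (t j) (pow_ne_zero m hs0)]
    exact div_mem hts (pow_mem hsE m)
  have hle : IntermediateField.adjoin 𝒦 (Set.range t) ≤ E :=
    IntermediateField.adjoin_le_iff.2 (Set.range_subset_iff.2 hmem)
  refine ⟨hmem, hle, ?_⟩
  have hζ' : IsPrimitiveRoot (⟨ζ, hζK⟩ : 𝒦) (p ^ n) :=
    IsPrimitiveRoot.of_map_of_injective (f := algebraMap 𝒦 (AlgebraicClosure ℚ_[p])) hζ
      (algebraMap 𝒦 (AlgebraicClosure ℚ_[p])).injective
  have hEdvd : Module.finrank 𝒦 E ∣ p ^ n :=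
    hζ'.finrank_adjoin_simple_dvd (c := algebraMap ℚ_[p] 𝒦 (1 + p)) hs
  exact (IntermediateField.finrank_dvd_of_le_right hle).trans hEdvd
end
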